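/- F₃(√−3/6 + 1/2) = 7√3·π³/810 − ζ(3)/2, where √−3 denotes i√3. -/

import Mathlib

open scoped Real

/-- `F₃(τ) = Σ_{m≥1} Σ_{n≥1} e^{2πimnτ}/n³`. -/
noncomputable def F₃ (τ : ℂ) : ℂ :=
  ∑' m : ℕ, ∑' n : ℕ,
    Complex.exp (2 * Real.pi * Complex.I * ((m : ℂ) + 1) * ((n : ℂ) + 1) * τ) / ((n : ℂ) + 1) ^ 3

open Complex in
lemma sq_im_le_norm_sq_sub_sq (z : ℂ) (k : ℝ) : z.im ^ 2 ≤ ‖z ^ 2 - (k : ℂ) ^ 2‖ := by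
  have h₁ : |z.im| ≤ ‖z - k‖ := by simpa using abs_im_le_norm (z - k)
  have h₂ : |z.im| ≤ ‖z + k‖ := by simpa using abs_im_le_norm (z + k)
  rw [show z ^ 2 - (k : ℂ) ^ 2 = (z - k) * (z + k) by ring, norm_mul, ← sq_abs, sq]
  gcongr

lemma summable_one_div_nat_add_one_pow {k : ℕ} (hk : 1 < k) :
    Summable fun n : ℕ ↦ 1 / ((n : ℝ) + 1) ^ k := by
  have := (summable_nat_add_iff 1).2 (Real.summable_one_div_nat_pow.2 hk)
  simpa using this

lemma hasSum_one_div_nat_add_one_pow {k : ℕ} (hk : 1 < k) :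
    HasSum (fun n : ℕ ↦ 1 / ((n : ℂ) + 1) ^ k) (riemannZeta k) := by
  have hs : Summable fun n : ℕ ↦ 1 / ((n : ℂ) + 1) ^ k := by
    have := Complex.ofRealCLM.summable (summable_one_div_nat_add_one_pow hk)
    simpa using this
  have hz := zeta_eq_tsum_one_div_nat_add_one_cpow (s := k) (by simpa using hk)
  simp only [Complex.cpow_natCast] at hz
  rw [hz]
  exact hs.hasSum

lemma nat_add_one_mul_im_pos {τ : ℂ} (hτ : 0 < τ.im) (n : ℕ) : 0 < (((n : ℂ) + 1) * τ).im := by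
  have : (((n : ℂ) + 1) * τ).im = ((n : ℝ) + 1) * τ.im := by simp
  rw [this]
  positivity

lemma neg_one_div_im_pos {τ : ℂ} (hτ : 0 < τ.im) : 0 < (-1 / τ).im := by
  have h0 : τ ≠ 0 := by rintro rfl; simp at hτ
  have : (-1 / τ).im = τ.im / Complex.normSq τ := by
    rw [neg_div, one_div, Complex.neg_im, Complex.inv_im]; ring
  rw [this]
  exact div_pos hτ (Complex.normSq_pos.2 h0)

lemma sq_mul_sq_sub_sq_ne_zero {τ : ℂ} (hτ : 0 < τ.im) (n m : ℕ) :
    ((n : ℂ) + 1) ^ 2 * τ ^ 2 - ((m : ℂ) + 1) ^ 2 ≠ 0 := by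
  have h := sq_im_le_norm_sq_sub_sq (((n : ℂ) + 1) * τ) ((m : ℝ) + 1)
  have h' := nat_add_one_mul_im_pos hτ n
  intro h0
  have : (((n : ℂ) + 1) * τ) ^ 2 - (((m : ℝ) + 1 : ℝ) : ℂ) ^ 2 = 0 := by
    push_cast; rw [mul_pow]; exact h0
  rw [this, norm_zero] at h
  nlinarith

lemma summable_one_div_snd_sq_mul {τ : ℂ} (hτ : 0 < τ.im) :
    Summable fun p : ℕ × ℕ ↦ 1 / (((p.2 : ℂ) + 1) ^ 2 *
      (((p.1 : ℂ) + 1) ^ 2 * τ ^ 2 - ((p.2 : ℂ) + 1) ^ 2)) := by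
  have hs := ((summable_one_div_nat_add_one_pow (k := 2) (by norm_num)).mul_of_nonneg
    (summable_one_div_nat_add_one_pow (k := 2) (by norm_num)) (fun _ ↦ by positivity)
    (fun _ ↦ by positivity)).mul_left (1 / τ.im ^ 2)
  refine Summable.of_norm_bounded hs fun p ↦ ?_
  have h := sq_im_le_norm_sq_sub_sq (((p.1 : ℂ) + 1) * τ) ((p.2 : ℝ) + 1)
  have him : (((p.1 : ℂ) + 1) * τ).im = ((p.1 : ℝ) + 1) * τ.im := by simp
  rw [him] at h
  push_cast at h
  rw [mul_pow, mul_pow] at h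
  have hn : ‖(p.2 : ℂ) + 1‖ = (p.2 : ℝ) + 1 := by
    rw [← Nat.cast_add_one, Complex.norm_natCast]; push_cast; rfl
  rw [norm_div, norm_mul, norm_pow, hn, norm_one, one_div_mul_one_div, one_div_mul_one_div]
  apply one_div_le_one_div_of_le (by positivity)
  calc _ = ((p.2 : ℝ) + 1) ^ 2 * (((p.1 : ℝ) + 1) ^ 2 * τ.im ^ 2) := by ring
    _ ≤ _ := by gcongr

/-- The double series `∑ 1 / (n² (n²τ² - m²))` over positive integers, arising from the partial
fractions of `∑ cot (π n τ) / n³`. -/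
noncomputable def cotDoubleSum (τ : ℂ) : ℂ :=
  ∑' p : ℕ × ℕ, 1 / (((p.1 : ℂ) + 1) ^ 2 *
    (((p.1 : ℂ) + 1) ^ 2 * τ ^ 2 - ((p.2 : ℂ) + 1) ^ 2))

lemma sq_mul_sq_sub_sq_eq_neg_one_div {τ : ℂ} (hτ : τ ≠ 0) (a b : ℂ) :
    a ^ 2 * τ ^ 2 - b ^ 2 = -τ ^ 2 * (b ^ 2 * (-1 / τ) ^ 2 - a ^ 2) := by
  field_simp
  ring

lemma cotDoubleSum_term_neg_one_div {τ : ℂ} (hτ : 0 < τ.im) (n m : ℕ) :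
    1 / (((m : ℂ) + 1) ^ 2 * (((n : ℂ) + 1) ^ 2 * τ ^ 2 - ((m : ℂ) + 1) ^ 2)) =
    -(1 / τ ^ 2) * (1 / (((m : ℂ) + 1) ^ 2 *
      (((m : ℂ) + 1) ^ 2 * (-1 / τ) ^ 2 - ((n : ℂ) + 1) ^ 2))) := by
  have h0 : τ ≠ 0 := by rintro rfl; simp at hτ
  rw [sq_mul_sq_sub_sq_eq_neg_one_div h0]
  field_simp

lemma summable_cotDoubleSum {τ : ℂ} (hτ : 0 < τ.im) :
    Summable fun p : ℕ × ℕ ↦ 1 / (((p.1 : ℂ) + 1) ^ 2 *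
      (((p.1 : ℂ) + 1) ^ 2 * τ ^ 2 - ((p.2 : ℂ) + 1) ^ 2)) := by
  have h0 : τ ≠ 0 := by rintro rfl; simp at hτ
  have hs := ((summable_one_div_snd_sq_mul (neg_one_div_im_pos hτ)).prod_symm).mul_left
    (-(1 / τ ^ 2))
  refine hs.congr fun p ↦ ?_
  rw [sq_mul_sq_sub_sq_eq_neg_one_div h0]
  simp only [Prod.fst_swap, Prod.snd_swap]
  field_simp

lemma cotDoubleSum_add_cotDoubleSum_neg_one_div {τ : ℂ} (hτ : 0 < τ.im) :
    cotDoubleSum τ + cotDoubleSum (-1 / τ) = -riemannZeta 2 ^ 2 := by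
  have h0 : τ ≠ 0 := by rintro rfl; simp at hτ
  have hz := hasSum_one_div_nat_add_one_pow (k := 2) (by norm_num)
  have hz2 : riemannZeta 2 ^ 2 =
      ∑' p : ℕ × ℕ, (1 / ((p.1 : ℂ) + 1) ^ 2) * (1 / ((p.2 : ℂ) + 1) ^ 2) := by
    rw [← tsum_mul_tsum_of_summable_norm hz.summable.norm hz.summable.norm, hz.tsum_eq]
    push_cast; ring
  have hS : cotDoubleSum (-1 / τ) = -τ ^ 2 * ∑' p : ℕ × ℕ, 1 / (((p.2 : ℂ) + 1) ^ 2 *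
      (((p.1 : ℂ) + 1) ^ 2 * τ ^ 2 - ((p.2 : ℂ) + 1) ^ 2)) := by
    simp_rw [cotDoubleSum_term_neg_one_div hτ]
    rw [tsum_mul_left, cotDoubleSum, ← (Equiv.prodComm ℕ ℕ).tsum_eq]
    simp only [Equiv.prodComm_apply, Prod.fst_swap, Prod.snd_swap]
    field_simp
  rw [hS, hz2, cotDoubleSum, ← tsum_mul_left, ← (summable_cotDoubleSum hτ).tsum_add
    ((summable_one_div_snd_sq_mul hτ).mul_left _), ← tsum_neg]
  refine tsum_congr fun p ↦ ?_
  have h1 := sq_mul_sq_sub_sq_ne_zero hτ p.1 p.2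
  have h3 : (p.1 : ℂ) + 1 ≠ 0 := Nat.cast_add_one_ne_zero p.1
  have h4 : (p.2 : ℂ) + 1 ≠ 0 := Nat.cast_add_one_ne_zero p.2
  field_simp
  ring

open Complex in
lemma pi_add_two_pi_tsum_exp_pow_eq {z : ℂ} (hz : 0 < z.im) :
    π * I + 2 * π * I * ∑' m : ℕ, exp (2 * π * I * z) ^ (m + 1) =
      -(1 / z) - ∑' m : ℕ, 2 * z / (z ^ 2 - ((m : ℂ) + 1) ^ 2) := by
  have hq := UpperHalfPlane.norm_exp_two_pi_I_lt_one ⟨z, hz⟩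
  have h1 := pi_mul_cot_pi_q_exp ⟨z, hz⟩
  have h2 := cot_series_rep' (UpperHalfPlane.coe_mem_integerComplement ⟨z, hz⟩)
  simp only at h1 h2 hq
  rw [(summable_geometric_of_norm_lt_one hq).tsum_eq_zero_add] at h1
  have h3 : ∑' m : ℕ, 2 * z / (z ^ 2 - ((m : ℂ) + 1) ^ 2) =
      ∑' m : ℕ, (1 / (z - (m + 1)) + 1 / (z + (m + 1))) := by
    refine tsum_congr fun m ↦ ?_
    have ha : z - (m + 1) ≠ 0 := fun h ↦ by
      have := congrArg im h; simp at this; exact hz.ne' this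
    have hb : z + (m + 1) ≠ 0 := fun h ↦ by
      have := congrArg im h; simp at this; exact hz.ne' this
    rw [show z ^ 2 - ((m : ℂ) + 1) ^ 2 = (z - (m + 1)) * (z + (m + 1)) by ring]
    field_simp
    ring
  rw [h3, ← h2, h1]
  ring

open Complex in
lemma summable_F₃ {τ : ℂ} (hτ : 0 < τ.im) :
    Summable fun p : ℕ × ℕ ↦
      exp (2 * π * I * ((p.1 : ℂ) + 1) * ((p.2 : ℂ) + 1) * τ) / ((p.2 : ℂ) + 1) ^ 3 := by
  have hq : ‖exp (2 * π * I * τ)‖ < 1 :=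
    UpperHalfPlane.norm_exp_two_pi_I_lt_one ⟨τ, hτ⟩
  have hs := (summable_geometric_of_lt_one (norm_nonneg _) hq).mul_of_nonneg
    (summable_one_div_nat_add_one_pow (k := 3) (by norm_num)) (fun _ ↦ by positivity)
    (fun _ ↦ by positivity)
  refine Summable.of_norm_bounded hs fun p ↦ ?_
  have hn : ‖(p.2 : ℂ) + 1‖ = (p.2 : ℝ) + 1 := by
    rw [← Nat.cast_add_one, Complex.norm_natCast]; push_cast; rfl
  have he : exp (2 * π * I * ((p.1 : ℂ) + 1) * ((p.2 : ℂ) + 1) * τ) =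
      exp (2 * π * I * τ) ^ ((p.1 + 1) * (p.2 + 1)) := by
    rw [← exp_nat_mul]; push_cast; ring_nf
  rw [norm_div, norm_pow, hn, he, norm_pow, div_eq_mul_one_div]
  gcongr ?_ * _
  exact pow_le_pow_of_le_one (norm_nonneg _) hq.le (by nlinarith)

open Complex in
lemma pi_mul_zeta_three_add_F₃ {τ : ℂ} (hτ : 0 < τ.im) :
    π * I * (riemannZeta 3 + 2 * F₃ τ) = -(riemannZeta 4 / τ) - 2 * τ * cotDoubleSum τ := by
  have h0 : τ ≠ 0 := by rintro rfl; simp at hτ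
  have hz3 := hasSum_one_div_nat_add_one_pow (k := 3) (by norm_num)
  have hz4 := hasSum_one_div_nat_add_one_pow (k := 4) (by norm_num)
  push_cast at hz3 hz4
  have hF : HasSum (fun n : ℕ ↦ ∑' m : ℕ,
      exp (2 * π * I * ((m : ℂ) + 1) * ((n : ℂ) + 1) * τ) / ((n : ℂ) + 1) ^ 3) (F₃ τ) := by
    have hs := summable_F₃ hτ
    rw [F₃, ← Summable.tsum_comm (f := fun m n : ℕ ↦
      exp (2 * π * I * ((m : ℂ) + 1) * ((n : ℂ) + 1) * τ) / ((n : ℂ) + 1) ^ 3) hs]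
    exact hs.prod_symm.prod.hasSum
  have hC : HasSum (fun n : ℕ ↦ ∑' m : ℕ, 1 / (((n : ℂ) + 1) ^ 2 *
      (((n : ℂ) + 1) ^ 2 * τ ^ 2 - ((m : ℂ) + 1) ^ 2))) (cotDoubleSum τ) := by
    rw [cotDoubleSum, (summable_cotDoubleSum hτ).tsum_prod]
    exact (summable_cotDoubleSum hτ).prod.hasSum
  have hl := (hz3.add (hF.mul_left 2)).mul_left (π * I)
  have hr := (hz4.div_const τ).neg.sub (hC.mul_left (2 * τ))
  refine hl.tsum_eq.symm.trans ((tsum_congr fun n ↦ ?_).trans hr.tsum_eq)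
  have hn : (n : ℂ) + 1 ≠ 0 := Nat.cast_add_one_ne_zero n
  have h := pi_add_two_pi_tsum_exp_pow_eq (nat_add_one_mul_im_pos hτ n)
  have he : ∑' m : ℕ, exp (2 * π * I * ((m : ℂ) + 1) * ((n : ℂ) + 1) * τ) / ((n : ℂ) + 1) ^ 3 =
      (∑' m : ℕ, exp (2 * π * I * (((n : ℂ) + 1) * τ)) ^ (m + 1)) / ((n : ℂ) + 1) ^ 3 := by
    rw [← tsum_div_const]
    refine tsum_congr fun m ↦ ?_
    rw [← exp_nat_mul]
    push_cast
    ring_nf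
  have hc : ∑' m : ℕ, 1 / (((n : ℂ) + 1) ^ 2 *
      (((n : ℂ) + 1) ^ 2 * τ ^ 2 - ((m : ℂ) + 1) ^ 2)) =
      (∑' m : ℕ, 2 * (((n : ℂ) + 1) * τ) / ((((n : ℂ) + 1) * τ) ^ 2 - ((m : ℂ) + 1) ^ 2)) *
        (1 / (2 * τ * ((n : ℂ) + 1) ^ 3)) := by
    rw [← tsum_mul_right]
    refine tsum_congr fun m ↦ ?_
    have := sq_mul_sq_sub_sq_ne_zero hτ n m
    rw [mul_pow]
    field_simp
  rw [he, hc]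
  field_simp at h ⊢
  linear_combination h

lemma F₃_add_one (τ : ℂ) : F₃ (τ + 1) = F₃ τ := by
  refine tsum_congr fun m ↦ tsum_congr fun n ↦ ?_
  congr 1
  refine Complex.exp_eq_exp_iff_exists_int.2 ⟨(m + 1) * (n + 1), ?_⟩
  push_cast
  ring

open Complex in
/-- Ramanujan's transformation formula for the Eichler integral `F₃` under `τ ↦ -1 / τ`. -/
lemma F₃_sub_sq_mul_F₃_neg_one_div {τ : ℂ} (hτ : 0 < τ.im) :
    π * I * (riemannZeta 3 + 2 * F₃ τ) - τ ^ 2 * (π * I * (riemannZeta 3 + 2 * F₃ (-1 / τ))) =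
      2 * τ * riemannZeta 2 ^ 2 - riemannZeta 4 * (1 / τ + τ ^ 3) := by
  have h0 : τ ≠ 0 := by rintro rfl; simp at hτ
  have h := cotDoubleSum_add_cotDoubleSum_neg_one_div hτ
  rw [pi_mul_zeta_three_add_F₃ hτ, pi_mul_zeta_three_add_F₃ (neg_one_div_im_pos hτ)]
  have h1 : τ ^ 2 * (2 * (-1 / τ) * cotDoubleSum (-1 / τ)) =
      -(2 * τ * cotDoubleSum (-1 / τ)) := by
    field_simp
  have h2 : τ ^ 2 * (riemannZeta 4 / (-1 / τ)) = -(riemannZeta 4 * τ ^ 3) := by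
    field_simp
  linear_combination (-2 * τ) * h + h1 + h2

theorem F₃_value_b :
    F₃ (Real.sqrt 3 * Complex.I / 6 + 1 / 2) =
      ((7 * Real.sqrt 3 * Real.pi ^ 3 / 810 : ℝ) : ℂ) - riemannZeta 3 / 2 := by
  have h3 : ((√3 : ℝ) : ℂ) ^ 2 = 3 := by norm_cast; norm_num
  have hI : Complex.I ^ 2 = -1 := Complex.I_sq
  obtain ⟨s, hs⟩ : ∃ s : ℂ, s = √3 * Complex.I := ⟨_, rfl⟩
  have hs2 : s ^ 2 = -3 := by rw [hs, mul_pow, h3, hI]; norm_num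
  have him : 0 < s.im := by simp [hs]
  have hτ : 0 < (s / 6 + 1 / 2).im := by simpa using him
  have hρ : 0 < ((s - 1) / 2).im := by simpa using him
  have hτ0 : s / 6 + 1 / 2 ≠ 0 := fun h ↦ by rw [h] at hτ; simp at hτ
  have hρ0 : (s - 1) / 2 ≠ 0 := fun h ↦ by rw [h] at hρ; simp at hρ
  have hτ' : 1 / (s / 6 + 1 / 2) = (3 - s) / 2 := by
    rw [div_eq_iff hτ0]; linear_combination (1 / 12) * hs2
  have hρ' : 1 / ((s - 1) / 2) = -((s + 1) / 2) := by
    rw [div_eq_iff hρ0]; linear_combination (1 / 4) * hs2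
  have hτ2 : (s / 6 + 1 / 2) ^ 2 = (1 + s) / 6 := by linear_combination (1 / 36) * hs2
  have hτ3 : (s / 6 + 1 / 2) ^ 3 = s / 9 := by linear_combination ((s + 9) / 216) * hs2
  have hρ2 : ((s - 1) / 2) ^ 2 = -((1 + s) / 2) := by linear_combination (1 / 4) * hs2
  have hρ3 : ((s - 1) / 2) ^ 3 = 1 := by linear_combination ((s - 3) / 8) * hs2
  have hFτ := F₃_sub_sq_mul_F₃_neg_one_div hτ
  have hFρ := F₃_sub_sq_mul_F₃_neg_one_div hρ
  rw [hτ2, hτ3, neg_div, hτ', ← F₃_add_one (-((3 - s) / 2)),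
    show -((3 - s) / 2) + 1 = (s - 1) / 2 by ring] at hFτ
  rw [hρ2, hρ3, neg_div, hρ', show -(-((s + 1) / 2)) = (s - 1) / 2 + 1 by ring, F₃_add_one] at hFρ
  rw [riemannZeta_two, riemannZeta_four] at hFτ hFρ
  rw [← hs]
  have hπ : (π : ℂ) * Complex.I ≠ 0 := by simp [Real.pi_ne_zero]
  have hX : (π : ℂ) * Complex.I * (riemannZeta 3 + 2 * F₃ (s / 6 + 1 / 2)) =
      7 * s * π ^ 4 / 405 := by
    generalize (π : ℂ) * Complex.I * (riemannZeta 3 + 2 * F₃ (s / 6 + 1 / 2)) = X at *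
    generalize (π : ℂ) * Complex.I * (riemannZeta 3 + 2 * F₃ ((s - 1) / 2)) = Y at *
    have hY : Y = s * π ^ 4 / 45 := by
      linear_combination (3 - s) / 6 * hFρ + (Y / 12 - π ^ 4 / 180) * hs2
    rw [hY] at hFτ
    linear_combination hFτ + π ^ 4 / 270 * hs2
  rw [hs] at hX ⊢
  push_cast
  apply mul_left_cancel₀ hπ
  linear_combination hX / 2
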